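/- Let w : ℝ² → ℝ be a C² function and set K(y) = Δw(y) + |∇w(y)|², where Δ is the Euclidean Laplacian and ∇ the Euclidean gradient. If ∫_{ℝ²} |K(y)| dy < ∞ and ∫_{ℝ²} K(y) dy ≤ 0, then w is constant (and consequently K ≡ 0). -/

import Mathlib

open MeasureTheory

/-- The Euclidean Laplacian of a function on `ℝ²`, as the trace of the second
derivative. -/
noncomputable def euclLap (w : EuclideanSpace ℝ (Fin 2) → ℝ)
    (y : EuclideanSpace ℝ (Fin 2)) : ℝ :=
  ∑ i : Fin 2,
    fderiv ℝ (fderiv ℝ w) y (EuclideanSpace.single i 1) (EuclideanSpace.single i 1)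

local notation "ℝ²" => EuclideanSpace ℝ (Fin 2)

open Filter Topology

/-- Pairing of the gradients of `η` and `w`, written in coordinates. -/
noncomputable def gradPairing (η w : ℝ² → ℝ) (y : ℝ²) : ℝ :=
  ∑ i : Fin 2, fderiv ℝ η y (EuclideanSpace.single i 1) * fderiv ℝ w y (EuclideanSpace.single i 1)

lemma continuous_gradPairing {η w : ℝ² → ℝ} (hη : ContDiff ℝ 1 η) (hw : ContDiff ℝ 1 w) :
    Continuous (gradPairing η w) := by
  have h1 := hη.continuous_fderiv one_ne_zero
  have h2 := hw.continuous_fderiv one_ne_zero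
  unfold gradPairing
  fun_prop

lemma abs_gradPairing_le (η w : ℝ² → ℝ) (y : ℝ²) :
    |gradPairing η w y| ≤ 2 * (‖fderiv ℝ η y‖ * ‖fderiv ℝ w y‖) := by
  have key (f : ℝ² → ℝ) (i : Fin 2) :
      |fderiv ℝ f y (EuclideanSpace.single i 1)| ≤ ‖fderiv ℝ f y‖ := by
    simpa using (fderiv ℝ f y).le_opNorm (EuclideanSpace.single i (1 : ℝ))
  calc |gradPairing η w y|
      ≤ ∑ i : Fin 2, |fderiv ℝ η y (EuclideanSpace.single i 1) *
          fderiv ℝ w y (EuclideanSpace.single i 1)| := Finset.abs_sum_le_sum_abs _ _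
    _ ≤ ∑ _i : Fin 2, ‖fderiv ℝ η y‖ * ‖fderiv ℝ w y‖ := by
        refine Finset.sum_le_sum fun i _ => ?_
        rw [abs_mul]
        exact mul_le_mul (key η i) (key w i) (abs_nonneg _) (norm_nonneg _)
    _ = 2 * (‖fderiv ℝ η y‖ * ‖fderiv ℝ w y‖) := by simp

lemma continuous_euclLap {w : ℝ² → ℝ} (hw : ContDiff ℝ 2 w) : Continuous (euclLap w) := by
  have h : ContDiff ℝ 1 (fderiv ℝ w) := hw.fderiv_right (by norm_num)
  have h2 := h.continuous_fderiv one_ne_zero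
  unfold euclLap
  fun_prop

/-- Green's identity against a compactly supported test function. -/
lemma integral_mul_euclLap {η w : ℝ² → ℝ} (hη : ContDiff ℝ 1 η) (hc : HasCompactSupport η)
    (hw : ContDiff ℝ 2 w) :
    ∫ y, η y * euclLap w y = -∫ y, gradPairing η w y := by
  have h : ContDiff ℝ 1 (fderiv ℝ w) := hw.fderiv_right (by norm_num)
  have h0 := h.continuous
  have h2 := h.continuous_fderiv one_ne_zero
  have hη0 := hη.continuous
  have hη1 := hη.continuous_fderiv one_ne_zero
  have int1 (v : ℝ²) : Integrable fun y => η y * fderiv ℝ (fderiv ℝ w) y v v :=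
    Continuous.integrable_of_hasCompactSupport (by fun_prop) hc.mul_right
  have int2 (v : ℝ²) : Integrable fun y => fderiv ℝ η y v * fderiv ℝ w y v :=
    Continuous.integrable_of_hasCompactSupport (by fun_prop) (hc.fderiv_apply ℝ v).mul_right
  have int3 (v : ℝ²) : Integrable fun y => η y * fderiv ℝ w y v :=
    Continuous.integrable_of_hasCompactSupport (by fun_prop) hc.mul_right
  have parts (v : ℝ²) : ∫ y, η y * fderiv ℝ (fderiv ℝ w) y v v =
      -∫ y, fderiv ℝ η y v * fderiv ℝ w y v := by
    have e (y : ℝ²) : fderiv ℝ (fun z => fderiv ℝ w z v) y v =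
        fderiv ℝ (fderiv ℝ w) y v v := by
      rw [fderiv_clm_apply (h.differentiable one_ne_zero y) (differentiableAt_const v)]
      simp
    simp_rw [← e]
    refine integral_mul_fderiv_eq_neg_fderiv_mul_of_integrable (int2 v) ?_ (int3 v)
      (fun y _ => hη.differentiable one_ne_zero y) (fun y _ => ?_)
    · simpa only [e] using int1 v
    · exact (h.differentiable one_ne_zero y).clm_apply (differentiableAt_const v)
  simp only [euclLap, gradPairing, Finset.mul_sum]
  rw [integral_finsetSum _ fun i _ => int1 _, integral_finsetSum _ fun i _ => int2 _,
    ← Finset.sum_neg_distrib]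
  exact Finset.sum_congr rfl fun i _ => parts _

/-- The equation `Δw + |∇w|² = K` tested with `η²`. -/
lemma integral_sq_mul_norm_fderiv_sq {η w K : ℝ² → ℝ} (hη : ContDiff ℝ 1 η)
    (hc : HasCompactSupport η) (hw : ContDiff ℝ 2 w)
    (hK : ∀ y, K y = euclLap w y + ‖fderiv ℝ w y‖ ^ 2) :
    ∫ y, η y ^ 2 * ‖fderiv ℝ w y‖ ^ 2 =
      (∫ y, η y ^ 2 * K y) + ∫ y, 2 * η y * gradPairing η w y := by
  have hw1 := hw.continuous_fderiv two_ne_zero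
  have hL := continuous_euclLap hw
  have hη0 := hη.continuous
  have hc2 : HasCompactSupport fun y => η y ^ 2 := hc.comp_left (g := fun t : ℝ => t ^ 2) (by simp)
  have green := integral_mul_euclLap (hη.pow 2) hc2 hw
  have pair (y : ℝ²) : gradPairing (fun y => η y ^ 2) w y = 2 * η y * gradPairing η w y := by
    simp only [gradPairing, Finset.mul_sum]
    refine Finset.sum_congr rfl fun i _ => ?_
    rw [fderiv_fun_pow 2 (hη.differentiable one_ne_zero y)]
    simp
    ring
  simp_rw [pair] at green
  simp_rw [hK, mul_add]
  rw [integral_add, green]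
  · ring
  · exact Continuous.integrable_of_hasCompactSupport (by fun_prop) hc2.mul_right
  · exact Continuous.integrable_of_hasCompactSupport (by fun_prop) hc2.mul_right

/-- The Dirichlet energy in the plane is invariant under dilations. -/
lemma integral_norm_fderiv_sq_comp_inv_smul (f : ℝ² → ℝ) {R : ℝ} (hR : 0 < R) :
    ∫ y, ‖fderiv ℝ (fun z => f (R⁻¹ • z)) y‖ ^ 2 = ∫ y, ‖fderiv ℝ f y‖ ^ 2 := by
  have e (y : ℝ²) : ‖fderiv ℝ (fun z => f (R⁻¹ • z)) y‖ ^ 2 =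
      (R⁻¹) ^ 2 * ‖fderiv ℝ f (R⁻¹ • y)‖ ^ 2 := by
    rw [fderiv_comp_smul, norm_smul, mul_pow]
    simp
  simp_rw [e]
  rw [integral_const_mul,
    Measure.integral_comp_inv_smul volume (fun y => ‖fderiv ℝ f y‖ ^ 2) R]
  simp only [finrank_euclideanSpace, Fintype.card_fin, smul_eq_mul, abs_pow, sq_abs]
  field_simp

/-- Cut-offs in the plane exhausting the space with uniformly bounded Dirichlet energy. -/
lemma exists_cutoffs : ∃ (η : ℕ → ℝ² → ℝ) (C : ℝ), (∀ n, ContDiff ℝ 1 (η n)) ∧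
    (∀ n, HasCompactSupport (η n)) ∧ (∀ n y, 0 ≤ η n y) ∧ (∀ n y, η n y ≤ 1) ∧
    (∀ n : ℕ, ∀ y ∈ Metric.ball (0 : ℝ²) n, η n y = 1) ∧
    (∀ n, ∫ y, ‖fderiv ℝ (η n) y‖ ^ 2 = C) := by
  let f : ContDiffBump (0 : ℝ²) := ⟨1, 2, one_pos, one_lt_two⟩
  have pos (n : ℕ) : (0 : ℝ) < n + 1 := by positivity
  refine ⟨fun n y => f (((n : ℝ) + 1)⁻¹ • y), ∫ y, ‖fderiv ℝ f y‖ ^ 2, fun n => ?_, fun n => ?_,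
    fun n y => f.nonneg, fun n y => f.le_one, fun n y hy => ?_,
    fun n => integral_norm_fderiv_sq_comp_inv_smul f (pos n)⟩
  · exact f.contDiff.comp (contDiff_const_smul _)
  · exact f.hasCompactSupport.comp_smul (inv_ne_zero (pos n).ne')
  · refine f.one_of_mem_closedBall ?_
    have hy' : ‖y‖ < n := by simpa using hy
    have : (n + 1 : ℝ)⁻¹ * ‖y‖ ≤ 1 := by
      rw [inv_mul_le_iff₀ (pos n)]
      linarith
    simpa [norm_smul, abs_of_pos (pos n), f] using this

lemma two_mul_mul_gradPairing_le {η w : ℝ² → ℝ} {y : ℝ²} (h0 : 0 ≤ η y) {ε : ℝ} (hε : 0 < ε) :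
    2 * η y * gradPairing η w y ≤
      ε * ‖fderiv ℝ η y‖ ^ 2 + 4 / ε * (η y ^ 2 * ‖fderiv ℝ w y‖ ^ 2) := by
  have h := (le_abs_self _).trans (abs_gradPairing_le η w y)
  have h1 : 2 * η y * gradPairing η w y ≤
      2 * η y * (2 * (‖fderiv ℝ η y‖ * ‖fderiv ℝ w y‖)) := by gcongr
  refine h1.trans ?_
  have h2 : 0 ≤ (ε * ‖fderiv ℝ η y‖ - 2 * (η y * ‖fderiv ℝ w y‖)) ^ 2 / ε := by positivity
  have h3 : (ε * ‖fderiv ℝ η y‖ - 2 * (η y * ‖fderiv ℝ w y‖)) ^ 2 / ε =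
      ε * ‖fderiv ℝ η y‖ ^ 2 + 4 / ε * (η y ^ 2 * ‖fderiv ℝ w y‖ ^ 2) -
        2 * η y * (2 * (‖fderiv ℝ η y‖ * ‖fderiv ℝ w y‖)) := by
    field_simp
    ring
  linarith

section
variable {w K : ℝ² → ℝ} {η : ℕ → ℝ² → ℝ} {C : ℝ}

lemma integrable_norm_fderiv_sq (hw : ContDiff ℝ 2 w)
    (hK : ∀ y, K y = euclLap w y + ‖fderiv ℝ w y‖ ^ 2) (hint : Integrable K)
    (hη : ∀ n, ContDiff ℝ 1 (η n)) (hc : ∀ n, HasCompactSupport (η n))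
    (h0 : ∀ n y, 0 ≤ η n y) (h1 : ∀ n y, η n y ≤ 1)
    (hball : ∀ n : ℕ, ∀ y ∈ Metric.ball (0 : ℝ²) n, η n y = 1)
    (hC : ∀ n, ∫ y, ‖fderiv ℝ (η n) y‖ ^ 2 = C) :
    Integrable fun y => ‖fderiv ℝ w y‖ ^ 2 := by
  have hw1 := hw.continuous_fderiv two_ne_zero
  have hG : Continuous fun y => ‖fderiv ℝ w y‖ ^ 2 := by fun_prop
  have cover : AECover (volume : Measure ℝ²) atTop fun n : ℕ => Metric.ball (0 : ℝ²) n :=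
    aecover_ball tendsto_natCast_atTop_atTop
  refine cover.integrable_of_integral_norm_bounded (2 * ((∫ y, ‖K y‖) + 8 * C))
    (fun n => (hG.locallyIntegrable.integrableOn_isCompact
      (isCompact_closedBall 0 n)).mono_set Metric.ball_subset_closedBall)
    (Eventually.of_forall fun n => ?_)
  have hη0 := (hη n).continuous
  have hη1 := (hη n).continuous_fderiv one_ne_zero
  have hP := continuous_gradPairing (hη n) (hw.of_le one_le_two)
  have hc2 : HasCompactSupport fun y => η n y ^ 2 :=
    (hc n).comp_left (g := fun t : ℝ => t ^ 2) (by simp)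
  have intG : Integrable fun y => η n y ^ 2 * ‖fderiv ℝ w y‖ ^ 2 :=
    Continuous.integrable_of_hasCompactSupport (by fun_prop) hc2.mul_right
  have intD : Integrable fun y => ‖fderiv ℝ (η n) y‖ ^ 2 :=
    Continuous.integrable_of_hasCompactSupport (by fun_prop)
      (((hc n).fderiv ℝ).comp_left (g := fun L : ℝ² →L[ℝ] ℝ => ‖L‖ ^ 2) (by simp))
  have intP : Integrable fun y => 2 * η n y * gradPairing (η n) w y :=
    Continuous.integrable_of_hasCompactSupport (by fun_prop)
      (HasCompactSupport.mul_right (hc n).mul_left)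
  have test := integral_sq_mul_norm_fderiv_sq (hη n) (hc n) hw hK
  have cross : ∫ y, 2 * η n y * gradPairing (η n) w y ≤
      8 * C + 4 / 8 * ∫ y, η n y ^ 2 * ‖fderiv ℝ w y‖ ^ 2 := by
    rw [← hC n, ← integral_const_mul, ← integral_const_mul,
      ← integral_add (intD.const_mul _) (intG.const_mul _)]
    exact integral_mono intP ((intD.const_mul _).add (intG.const_mul _)) fun y =>
      two_mul_mul_gradPairing_le (h0 n y) (by norm_num)
  have curv : ∫ y, η n y ^ 2 * K y ≤ ∫ y, ‖K y‖ := by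
    refine (Real.le_norm_self _).trans (norm_integral_le_of_norm_le hint.norm
      (Eventually.of_forall fun y => ?_))
    rw [norm_mul, Real.norm_of_nonneg (sq_nonneg _)]
    exact mul_le_of_le_one_left (norm_nonneg _) (pow_le_one₀ (h0 n y) (h1 n y))
  have restr : ∫ y in Metric.ball (0 : ℝ²) n, ‖‖fderiv ℝ w y‖ ^ 2‖ ≤
      ∫ y, η n y ^ 2 * ‖fderiv ℝ w y‖ ^ 2 := by
    rw [setIntegral_congr_fun (g := fun y => η n y ^ 2 * ‖fderiv ℝ w y‖ ^ 2)
      measurableSet_ball fun y hy => by simp [hball n y hy]]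
    exact setIntegral_le_integral intG (Eventually.of_forall fun y => by positivity)
  linarith

lemma integral_norm_fderiv_sq_le (hw : ContDiff ℝ 2 w)
    (hK : ∀ y, K y = euclLap w y + ‖fderiv ℝ w y‖ ^ 2) (hint : Integrable K)
    (hη : ∀ n, ContDiff ℝ 1 (η n)) (hc : ∀ n, HasCompactSupport (η n))
    (h0 : ∀ n y, 0 ≤ η n y) (h1 : ∀ n y, η n y ≤ 1)
    (hball : ∀ n : ℕ, ∀ y ∈ Metric.ball (0 : ℝ²) n, η n y = 1)
    (hC : ∀ n, ∫ y, ‖fderiv ℝ (η n) y‖ ^ 2 = C) :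
    ∫ y, ‖fderiv ℝ w y‖ ^ 2 ≤ ∫ y, K y := by
  have hw1 := hw.continuous_fderiv two_ne_zero
  have intG := integrable_norm_fderiv_sq hw hK hint hη hc h0 h1 hball hC
  have sq_le (n : ℕ) (y : ℝ²) : η n y ^ 2 ≤ 1 := pow_le_one₀ (h0 n y) (h1 n y)
  have inner_ball (y : ℝ²) : ∀ᶠ n : ℕ in atTop, y ∈ Metric.ball (0 : ℝ²) n := by
    filter_upwards [tendsto_natCast_atTop_atTop.eventually_gt_atTop ‖y‖] with n hn
    simpa using hn
  have limit {F : ℝ² → ℝ} (hF : Integrable F) :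
      Tendsto (fun n => ∫ y, η n y ^ 2 * F y) atTop (𝓝 (∫ y, F y)) := by
    refine tendsto_integral_of_dominated_convergence (fun y => ‖F y‖)
      (fun n => ((hη n).continuous.pow 2).aestronglyMeasurable.mul hF.aestronglyMeasurable)
      hF.norm (fun n => Eventually.of_forall fun y => ?_) (Eventually.of_forall fun y => ?_)
    · rw [norm_mul, Real.norm_of_nonneg (sq_nonneg _)]
      exact mul_le_of_le_one_left (norm_nonneg _) (sq_le n y)
    · refine tendsto_const_nhds.congr' ?_
      filter_upwards [inner_ball y] with n hn
      simp [hball n y hn]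
  let tail (n : ℕ) : ℝ² → ℝ := (Metric.ball (0 : ℝ²) n)ᶜ.indicator fun y => ‖fderiv ℝ w y‖ ^ 2
  have int_tail (n : ℕ) : Integrable (tail n) := intG.indicator measurableSet_ball.compl
  have lim_tail : Tendsto (fun n => ∫ y, tail n y) atTop (𝓝 0) := by
    rw [← integral_zero ℝ² ℝ]
    refine tendsto_integral_of_dominated_convergence (fun y => ‖fderiv ℝ w y‖ ^ 2)
      (fun n => (int_tail n).aestronglyMeasurable) intG
      (fun n => Eventually.of_forall fun y => ?_) (Eventually.of_forall fun y => ?_)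
    · exact (norm_indicator_le_norm_self _ _).trans (by simp)
    · refine tendsto_const_nhds.congr' ?_
      filter_upwards [inner_ball y] with n hn
      exact (Set.indicator_of_notMem (Set.notMem_compl_iff.2 hn) _).symm
  have cross {ε : ℝ} (hε : 0 < ε) (n : ℕ) : ∫ y, 2 * η n y * gradPairing (η n) w y ≤
      ε * C + 4 / ε * ∫ y, tail n y := by
    have hη0 := (hη n).continuous
    have hη1 := (hη n).continuous_fderiv one_ne_zero
    have hP := continuous_gradPairing (hη n) (hw.of_le one_le_two)
    have intD : Integrable fun y => ‖fderiv ℝ (η n) y‖ ^ 2 :=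
      Continuous.integrable_of_hasCompactSupport (by fun_prop)
        (((hc n).fderiv ℝ).comp_left (g := fun L : ℝ² →L[ℝ] ℝ => ‖L‖ ^ 2) (by simp))
    have intP : Integrable fun y => 2 * η n y * gradPairing (η n) w y :=
      Continuous.integrable_of_hasCompactSupport (by fun_prop)
        (HasCompactSupport.mul_right (hc n).mul_left)
    rw [← hC n, ← integral_const_mul, ← integral_const_mul,
      ← integral_add (intD.const_mul _) ((int_tail n).const_mul _)]
    refine integral_mono intP ((intD.const_mul _).add ((int_tail n).const_mul _)) fun y => ?_
    by_cases hy : y ∈ Metric.ball (0 : ℝ²) n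
    · have hd : fderiv ℝ (η n) y = 0 := by
        have : η n =ᶠ[𝓝 y] fun _ => 1 := by
          filter_upwards [Metric.isOpen_ball.mem_nhds hy] with z hz using hball n z hz
        rw [this.fderiv_eq, fderiv_const_apply]
      have ht : tail n y = 0 := Set.indicator_of_notMem (Set.notMem_compl_iff.2 hy) _
      simp [gradPairing, hd, ht]
    · have ht : tail n y = ‖fderiv ℝ w y‖ ^ 2 := Set.indicator_of_mem hy _
      refine (two_mul_mul_gradPairing_le (h0 n y) hε).trans ?_
      simp only [ht]
      gcongr
      exact mul_le_of_le_one_left (sq_nonneg _) (sq_le n y)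
  have bound {ε : ℝ} (hε : 0 < ε) : ∫ y, ‖fderiv ℝ w y‖ ^ 2 ≤ (∫ y, K y) + ε * C := by
    have lim : Tendsto (fun n => (∫ y, η n y ^ 2 * K y) + (ε * C + 4 / ε * ∫ y, tail n y)) atTop
        (𝓝 ((∫ y, K y) + (ε * C + 4 / ε * 0))) :=
      (limit hint).add ((lim_tail.const_mul _).const_add _)
    rw [mul_zero, add_zero] at lim
    refine le_of_tendsto_of_tendsto' (limit intG) lim fun n => ?_
    rw [integral_sq_mul_norm_fderiv_sq (hη n) (hc n) hw hK]
    gcongr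
    exact cross hε n
  have lim : Tendsto (fun ε : ℝ => (∫ y, K y) + ε * C) (𝓝[>] 0) (𝓝 ((∫ y, K y) + 0 * C)) :=
    Tendsto.mono_left (Continuous.tendsto (by fun_prop) 0) nhdsWithin_le_nhds
  rw [zero_mul, add_zero] at lim
  exact ge_of_tendsto lim (eventually_nhdsWithin_of_forall fun ε hε => bound hε)
end

/-- Fischer-Colbrie–Schoen step in the proof of Theorem 4.2: if `w` is C² on `ℝ²`
and `K = Δw + |∇w|²` is integrable with `∫ K ≤ 0`, then `w` is constant and
consequently `K ≡ 0`. -/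
theorem stmt_11 (w : EuclideanSpace ℝ (Fin 2) → ℝ) (hw : ContDiff ℝ 2 w)
    (K : EuclideanSpace ℝ (Fin 2) → ℝ)
    (hK : ∀ y, K y = euclLap w y + ‖gradient w y‖ ^ 2)
    (hint : Integrable K) (hneg : (∫ y, K y) ≤ 0) :
    (∀ y z, w y = w z) ∧ (∀ y, K y = 0) := by
  have grad (y : EuclideanSpace ℝ (Fin 2)) : ‖gradient w y‖ = ‖fderiv ℝ w y‖ := by
    simp [gradient]
  simp_rw [grad] at hK
  obtain ⟨η, C, hη, hc, h0, h1, hball, hC⟩ := exists_cutoffs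
  have intG := integrable_norm_fderiv_sq hw hK hint hη hc h0 h1 hball hC
  have hle := integral_norm_fderiv_sq_le hw hK hint hη hc h0 h1 hball hC
  have hw1 := hw.continuous_fderiv two_ne_zero
  have hzero : (fun y => ‖fderiv ℝ w y‖ ^ 2) = 0 := by
    refine (Continuous.ae_eq_iff_eq volume (by fun_prop) continuous_zero).1 ?_
    refine (integral_eq_zero_iff_of_nonneg (fun y => sq_nonneg _) intG).1 ?_
    exact le_antisymm (hle.trans hneg) (integral_nonneg fun y => sq_nonneg _)
  have hd (y : EuclideanSpace ℝ (Fin 2)) : fderiv ℝ w y = 0 := by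
    simpa using congrFun hzero y
  refine ⟨is_const_of_fderiv_eq_zero (hw.differentiable two_ne_zero) hd, fun y => ?_⟩
  have hd' : fderiv ℝ w = fun _ => 0 := funext hd
  simp [hK, euclLap, hd']
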